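/- Let X = (X,Σ,μ) be a measure space, K a compact Hausdorff space, and T : C(K;ℂ) → L¹(X) a linear operator. Then the following are equivalent: (i) T is order-bounded; (ii) T is regular; (iii) there is a finite positive regular Borel measure ν on K such that ‖Tf‖_{L¹(X)} ≤ ∫_K |f| dν for all f ∈ C(K). If (i)–(iii) hold, let ν₀ be the finite positive regular Borel measure on K with ∫_K f dν₀ = ∫_X |T|f dμ for all f ∈ C(K) (which exists by the Riesz representation theorem, since f ↦ ∫_X |T|f dμ is a positive linear functional on C(K)). Then ν₀ itself satisfies the bound in (iii), and ν₀ ≤ ν for every finite positive regular Borel measure ν satisfying the bound in (iii). In particular, if ν is as in (iii) then also ‖|T|f‖_{L¹(X)} ≤ ∫_K |f| dν for all f ∈ C(K). -/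

import Mathlib

open MeasureTheory ComplexConjugate
open scoped ENNReal ComplexOrder

noncomputable section

variable {K : Type*} [TopologicalSpace K] [CompactSpace K] [T2Space K]
  [MeasurableSpace K] [BorelSpace K]
variable {X : Type*} [MeasurableSpace X] {μ : Measure X}

/-- `T : C(K;ℂ) → L¹(X)` is order-bounded. -/
def OrderBounded (T : C(K, ℂ) → Lp ℂ 1 μ) : Prop :=
  ∀ f : C(K, ℂ), (∀ t, 0 ≤ f t) → ∃ h : Lp ℂ 1 μ, (∀ᵐ x ∂μ, 0 ≤ h x) ∧
    ∀ g : C(K, ℂ), (∀ t, (‖g t‖ : ℂ) ≤ f t) → ∀ᵐ x ∂μ, (‖T g x‖ : ℂ) ≤ h x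

/-- `T` is a positive operator. -/
def PositiveOp (T : C(K, ℂ) → Lp ℂ 1 μ) : Prop :=
  ∀ f : C(K, ℂ), (∀ t, 0 ≤ f t) → ∀ᵐ x ∂μ, 0 ≤ T f x

/-- `T` is regular: a linear combination of positive linear operators. -/
def RegularOp (T : C(K, ℂ) →ₗ[ℂ] Lp ℂ 1 μ) : Prop :=
  ∃ (n : ℕ) (c : Fin n → ℂ) (P : Fin n → (C(K, ℂ) →ₗ[ℂ] Lp ℂ 1 μ)),
    (∀ i, PositiveOp ⇑(P i)) ∧ T = ∑ i, c i • P i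

/-- `absT` is a linear modulus for `T`. -/
def IsLinearModulus (T absT : C(K, ℂ) → Lp ℂ 1 μ) : Prop :=
  ∀ f : C(K, ℂ), (∀ t, 0 ≤ f t) →
    (∀ g : C(K, ℂ), (∀ t, (‖g t‖ : ℂ) ≤ f t) →
        ∀ᵐ x ∂μ, (‖T g x‖ : ℂ) ≤ absT f x) ∧
    (∀ h : Lp ℂ 1 μ,
        (∀ g : C(K, ℂ), (∀ t, (‖g t‖ : ℂ) ≤ f t) → ∀ᵐ x ∂μ, (‖T g x‖ : ℂ) ≤ h x) →
        ∀ᵐ x ∂μ, absT f x ≤ h x)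

section LpOne

variable {Z : Type*} [MeasurableSpace Z] {m : Measure Z}

/-- The pointwise modulus `x ↦ ‖u x‖` of an integrable function, as an element of real `L¹`. -/
def lpAbs (u : Lp ℂ 1 m) : Lp ℝ 1 m := lipschitzWith_one_norm.compLp norm_zero u

theorem coeFn_lpAbs (u : Lp ℂ 1 m) : ∀ᵐ x ∂m, lpAbs u x = ‖u x‖ :=
  lipschitzWith_one_norm.coeFn_compLp norm_zero u

theorem norm_lpAbs (u : Lp ℂ 1 m) : ‖lpAbs u‖ = ‖u‖ := by
  rw [L1.norm_eq_integral_norm, L1.norm_eq_integral_norm]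
  refine integral_congr_ae ?_
  filter_upwards [coeFn_lpAbs u] with x hx
  simp [hx]

theorem lpAbs_nonneg (u : Lp ℂ 1 m) : 0 ≤ lpAbs u := by
  rw [← Lp.coeFn_nonneg]
  filter_upwards [coeFn_lpAbs u] with x hx
  simp [hx]

theorem lpAbs_zero : lpAbs (0 : Lp ℂ 1 m) = 0 :=
  LipschitzWith.compLp_zero _ _

theorem lpAbs_add_le (u v : Lp ℂ 1 m) : lpAbs (u + v) ≤ lpAbs u + lpAbs v := by
  rw [← Lp.coeFn_le]
  filter_upwards [coeFn_lpAbs u, coeFn_lpAbs v, coeFn_lpAbs (u + v), Lp.coeFn_add u v,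
    Lp.coeFn_add (lpAbs u) (lpAbs v)] with x h1 h2 h3 h4 h5
  rw [h3, h5, h4, Pi.add_apply, Pi.add_apply, h1, h2]
  exact norm_add_le _ _

theorem lpAbs_smul (c : ℂ) (u : Lp ℂ 1 m) : lpAbs (c • u) = ‖c‖ • lpAbs u := by
  refine Lp.ext ?_
  filter_upwards [coeFn_lpAbs u, coeFn_lpAbs (c • u), Lp.coeFn_smul c u,
    Lp.coeFn_smul ‖c‖ (lpAbs u)] with x h1 h2 h3 h4
  rw [h2, h4, h3, Pi.smul_apply, Pi.smul_apply, h1, norm_smul, smul_eq_mul]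

theorem lpAbs_sum_le {ι : Type*} (s : Finset ι) (u : ι → Lp ℂ 1 m) :
    lpAbs (∑ i ∈ s, u i) ≤ ∑ i ∈ s, lpAbs (u i) :=
  Finset.le_sum_of_subadditive lpAbs lpAbs_zero.le lpAbs_add_le s u

theorem norm_lpAbs_sub_le (u v : Lp ℂ 1 m) : ‖lpAbs u - lpAbs v‖ ≤ ‖u - v‖   :=
  (lipschitzWith_one_norm.norm_compLp_sub_le norm_zero u v).trans_eq (by simp)

theorem lp_norm_sub_of_nonneg_of_le {u v : Lp ℝ 1 m} (hu : 0 ≤ u) (huv : u ≤ v) :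
    ‖v - u‖ = ‖v‖ - ‖u‖ := by
  simp only [L1.norm_eq_integral_norm]
  rw [← integral_sub (L1.integrable_coeFn v).norm (L1.integrable_coeFn u).norm]
  refine integral_congr_ae ?_
  filter_upwards [(Lp.coeFn_nonneg u).2 hu, (Lp.coeFn_le u v).2 huv, Lp.coeFn_sub v u]
    with x h1 h2 h3
  simp only [Pi.zero_apply] at h1
  rw [h3, Pi.sub_apply, Real.norm_of_nonneg (sub_nonneg.2 h2), Real.norm_of_nonneg h1,
    Real.norm_of_nonneg (h1.trans h2)]

/-- Increasing norm-bounded nets in the positive cone of `L¹` converge in norm. -/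
theorem lp_exists_tendsto_of_monotone {α : Type*} [Preorder α] [IsDirectedOrder α] [Nonempty α]
    {F : α → Lp ℝ 1 m} (hF : Monotone F) (h0 : ∀ a, 0 ≤ F a) {C : ℝ} (hC : ∀ a, ‖F a‖ ≤ C) :
    ∃ u, Filter.Tendsto F Filter.atTop (nhds u) := by
  refine cauchy_map_iff_exists_tendsto.1 (Metric.cauchy_iff.2 ⟨inferInstance, fun ε hε ↦ ?_⟩)
  have hbdd : BddAbove (Set.range fun a ↦ ‖F a‖) := ⟨C, by rintro _ ⟨a, rfl⟩; exact hC a⟩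
  obtain ⟨a, ha⟩ := exists_lt_of_lt_ciSup (sub_lt_self (⨆ a, ‖F a‖) (half_pos hε))
  have key : ∀ b, a ≤ b → dist (F b) (F a) < ε / 2 := fun b hb ↦ by
    rw [dist_eq_norm, lp_norm_sub_of_nonneg_of_le (h0 a) (hF hb)]
    linarith [le_ciSup hbdd b]
  refine ⟨F '' Set.Ici a, Filter.image_mem_map (Filter.Ici_mem_atTop a), ?_⟩
  rintro _ ⟨b, hb, rfl⟩ _ ⟨c, hc, rfl⟩
  linarith [dist_triangle_right (F b) (F c) (F a), key b hb, key c hc]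

/-- The inclusion of real `L¹` into complex `L¹`. -/
def lpOfReal : Lp ℝ 1 m →L[ℝ] Lp ℂ 1 m := Complex.ofRealCLM.compLpL 1 m

theorem coeFn_lpOfReal (u : Lp ℝ 1 m) : ∀ᵐ x ∂m, lpOfReal u x = (u x : ℂ) :=
  Complex.ofRealCLM.coeFn_compLpL u

theorem norm_lpOfReal (u : Lp ℝ 1 m) : ‖lpOfReal u‖ = ‖u‖ := by
  rw [L1.norm_eq_integral_norm, L1.norm_eq_integral_norm]
  refine integral_congr_ae ?_
  filter_upwards [coeFn_lpOfReal u] with x hx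
  simp [hx]

end LpOne

section PartitionsOfOne

variable {Y : Type*} [TopologicalSpace Y]

/-- A finite family of continuous functions with sum `1` whose moduli sum to at most `1`, i.e. a
finite continuous partition of unity. -/
structure PartitionOfOne (Y : Type*) [TopologicalSpace Y] where
  /-- the index type -/
  ι : Type
  /-- the index type is finite -/
  fin : Fintype ι
  /-- the functions of the partition -/
  χ : ι → C(Y, ℂ)
  sum_eq : ∑ i, χ i = 1
  sum_norm_le : ∀ t, ∑ i, ‖χ i t‖ ≤ 1

attribute [instance] PartitionOfOne.fin

namespace PartitionOfOne

open Classical in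
/-- Partitions of unity are ordered by refinement. -/
instance : Preorder (PartitionOfOne Y) where
  le p q := ∃ σ : q.ι → p.ι, (∀ i, p.χ i = ∑ j, if σ j = i then q.χ j else 0) ∧
    ∀ j t, q.χ j t ≠ 0 → p.χ (σ j) t ≠ 0
  le_refl p := ⟨id, fun i ↦ by simp, fun _ _ h ↦ h⟩
  le_trans p q r := by
    rintro ⟨σ, hσ, hσ'⟩ ⟨τ, hτ, hτ'⟩
    refine ⟨σ ∘ τ, fun i ↦ ?_, fun k t h ↦ hσ' _ _ (hτ' _ _ h)⟩
    have h : ∀ j, (if σ j = i then q.χ j else 0) =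
        ∑ k, if τ k = j then (if σ j = i then r.χ k else 0) else 0 := fun j ↦ by
      split_ifs with hj
      · exact hτ j
      · simp
    rw [hσ i, Finset.sum_congr rfl fun j _ ↦ h j, Finset.sum_comm]
    simp

instance : Nonempty (PartitionOfOne Y) :=
  ⟨⟨Unit, inferInstance, fun _ ↦ 1, by simp, by simp⟩⟩

/-- The common refinement of two partitions consisting of all products. -/
def prod (p q : PartitionOfOne Y) : PartitionOfOne Y where
  ι := p.ι × q.ι
  fin := inferInstance
  χ i := p.χ i.1 * q.χ i.2
  sum_eq := by
    simp_rw [Fintype.sum_prod_type, ← Finset.mul_sum, q.sum_eq, mul_one, p.sum_eq]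
  sum_norm_le t := by
    simp_rw [Fintype.sum_prod_type, ContinuousMap.mul_apply, norm_mul, ← Finset.mul_sum,
      ← Finset.sum_mul]
    exact mul_le_one₀ (p.sum_norm_le t) (Finset.sum_nonneg fun _ _ ↦ norm_nonneg _)
      (q.sum_norm_le t)

open Classical in
instance : IsDirectedOrder (PartitionOfOne Y) where
  directed p q := by
    refine ⟨p.prod q, ⟨Prod.fst, fun i ↦ ?_, fun j t h ↦ left_ne_zero_of_mul h⟩,
      ⟨Prod.snd, fun i ↦ ?_, fun j t h ↦ right_ne_zero_of_mul h⟩⟩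
    · change _ = ∑ j : p.ι × q.ι, if j.1 = i then p.χ j.1 * q.χ j.2 else 0
      rw [Fintype.sum_prod_type, Finset.sum_eq_single i (fun b _ hb ↦ by simp [hb]) (by simp)]
      simp [← Finset.mul_sum, q.sum_eq]
    · change _ = ∑ j : p.ι × q.ι, if j.2 = i then p.χ j.1 * q.χ j.2 else 0
      rw [Fintype.sum_prod_type_right, Finset.sum_eq_single i (fun b _ hb ↦ by simp [hb]) (by simp)]
      simp [← Finset.sum_mul, p.sum_eq]

open Classical in
/-- A value of `f` on the support of the `i`-th function of the partition. -/
def sample (p : PartitionOfOne Y) (f : C(Y, ℂ)) (i : p.ι) : ℂ :=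
  if h : ∃ t, p.χ i t ≠ 0 then f h.choose else 0

theorem sample_add (p : PartitionOfOne Y) (f g : C(Y, ℂ)) (i : p.ι) :
    p.sample (f + g) i = p.sample f i + p.sample g i := by
  unfold sample; split_ifs <;> simp

theorem sample_smul (p : PartitionOfOne Y) (c : ℂ) (f : C(Y, ℂ)) (i : p.ι) :
    p.sample (c • f) i = c * p.sample f i := by
  unfold sample; split_ifs <;> simp

theorem norm_sample_sub_lt {p : PartitionOfOne Y} {f : C(Y, ℂ)} {ε : ℝ} {i : p.ι}
    (h : ∀ s t, p.χ i s ≠ 0 → p.χ i t ≠ 0 → ‖f s - f t‖ < ε) {t : Y} (ht : p.χ i t ≠ 0) :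
    ‖p.sample f i - f t‖ < ε := by
  have hex : ∃ t, p.χ i t ≠ 0 := ⟨t, ht⟩
  rw [sample, dif_pos hex]
  exact h _ _ hex.choose_spec ht

/-- On a compact space, every continuous function has small oscillation on the supports of all
sufficiently fine partitions. -/
theorem eventually_oscillation_lt [CompactSpace Y] [T2Space Y] (f : C(Y, ℂ)) {ε : ℝ} (hε : 0 < ε) :
    ∀ᶠ p : PartitionOfOne Y in Filter.atTop,
      ∀ i s t, p.χ i s ≠ 0 → p.χ i t ≠ 0 → ‖f s - f t‖ < ε := by
  obtain ⟨F, -, hF⟩ := (isCompact_univ (X := Y)).elim_nhds_subcover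
    (fun t ↦ f ⁻¹' Metric.ball (f t) (ε / 2))
    (fun t _ ↦ f.continuous.continuousAt (Metric.ball_mem_nhds _ (half_pos hε)))
  let e := F.equivFin
  obtain ⟨χ, hχ, hsum, h01, -⟩ := exists_continuous_sum_one_of_isOpen_isCompact
    (s := fun i : Fin F.card ↦ f ⁻¹' Metric.ball (f (e.symm i)) (ε / 2))
    (fun i ↦ Metric.isOpen_ball.preimage f.continuous) (isCompact_univ (X := Y))
    (fun t ht ↦ by
      obtain ⟨x, hx, hxt⟩ := Set.mem_iUnion₂.1 (hF ht)
      exact Set.mem_iUnion.2 ⟨e ⟨x, hx⟩, by simpa using hxt⟩)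
  have hsum' : ∀ t, ∑ i, χ i t = 1 := fun t ↦ by simpa using hsum (Set.mem_univ t)
  let p₀ : PartitionOfOne Y :=
    { ι := Fin F.card
      fin := inferInstance
      χ := fun i ↦ ⟨fun t ↦ (χ i t : ℂ), by fun_prop⟩
      sum_eq := by
        ext t
        simp [← Complex.ofReal_sum, hsum' t]
      sum_norm_le := fun t ↦ by
        refine le_of_eq ?_
        rw [← hsum' t]
        refine Finset.sum_congr rfl fun i _ ↦ ?_
        simp [(h01 i t).1] }
  filter_upwards [Filter.eventually_ge_atTop p₀] with p hp i s t hs ht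
  obtain ⟨σ, -, hσ⟩ := hp
  have hball : ∀ t, p.χ i t ≠ 0 → f t ∈ Metric.ball (f (e.symm (σ i))) (ε / 2) := fun t ht ↦
    hχ (σ i) (subset_tsupport _ (by
      have := hσ i t ht
      simpa [p₀] using this))
  rw [← dist_eq_norm]
  linarith [dist_triangle_right (f s) (f t) (f (e.symm (σ i))), Metric.mem_ball.1 (hball s hs),
    Metric.mem_ball.1 (hball t ht)]

end PartitionOfOne

end PartitionsOfOne

section Modulus

variable {Y : Type*} [TopologicalSpace Y] {Z : Type*} [MeasurableSpace Z] {m : Measure Z}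

/-- The pointwise modulus of a continuous function. -/
def modulusFun (f : C(Y, ℂ)) : C(Y, ℂ) := ⟨fun t ↦ (‖f t‖ : ℂ), by fun_prop⟩

theorem modulusFun_apply (f : C(Y, ℂ)) (t : Y) : modulusFun f t = (‖f t‖ : ℂ) := rfl

theorem modulusFun_nonneg (f : C(Y, ℂ)) (t : Y) : 0 ≤ modulusFun f t := by
  simp [modulusFun_apply]

theorem modulusFun_of_nonneg {f : C(Y, ℂ)} (hf : ∀ t, 0 ≤ f t) : modulusFun f = f := by
  ext t
  exact (Complex.eq_coe_norm_of_nonneg (hf t)).symm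

theorem PartitionOfOne.sample_modulusFun (p : PartitionOfOne Y) (f : C(Y, ℂ)) (i : p.ι) :
    p.sample (modulusFun f) i = (‖p.sample f i‖ : ℂ) := by
  unfold PartitionOfOne.sample; split_ifs <;> simp [modulusFun_apply]

/-- The sum of the moduli `|T (χᵢ g)|` over a partition of unity. -/
def variationSum (T : C(Y, ℂ) →ₗ[ℂ] Lp ℂ 1 m) (p : PartitionOfOne Y) (g : C(Y, ℂ)) : Lp ℝ 1 m :=
  ∑ i, lpAbs (T (p.χ i * g))

theorem lpAbs_le_variationSum (T : C(Y, ℂ) →ₗ[ℂ] Lp ℂ 1 m) (p : PartitionOfOne Y) (g : C(Y, ℂ)) :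
    lpAbs (T g) ≤ variationSum T p g := by
  have h : T g = ∑ i, T (p.χ i * g) := by
    rw [← map_sum, ← Finset.sum_mul, p.sum_eq, one_mul]
  rw [h]
  exact lpAbs_sum_le _ _

theorem variationSum_nonneg (T : C(Y, ℂ) →ₗ[ℂ] Lp ℂ 1 m) (p : PartitionOfOne Y) (g : C(Y, ℂ)) :
    0 ≤ variationSum T p g :=
  Finset.sum_nonneg fun _ _ ↦ lpAbs_nonneg _

open Classical in
theorem variationSum_mono (T : C(Y, ℂ) →ₗ[ℂ] Lp ℂ 1 m) (g : C(Y, ℂ)) :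
    Monotone fun p ↦ variationSum T p g := by
  rintro p q ⟨σ, hσ, -⟩
  calc variationSum T p g
      = ∑ i, lpAbs (∑ j, if σ j = i then T (q.χ j * g) else 0) := by
        refine Finset.sum_congr rfl fun i _ ↦ ?_
        rw [hσ i, Finset.sum_mul, map_sum]
        congr 1
        refine Finset.sum_congr rfl fun j _ ↦ ?_
        split_ifs <;> simp
    _ ≤ ∑ i, ∑ j, if σ j = i then lpAbs (T (q.χ j * g)) else 0 := by
        refine Finset.sum_le_sum fun i _ ↦ (lpAbs_sum_le _ _).trans_eq ?_
        refine Finset.sum_congr rfl fun j _ ↦ ?_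
        split_ifs
        · rfl
        · exact lpAbs_zero
    _ = variationSum T q g := by
        rw [Finset.sum_comm]
        simp [variationSum]

theorem norm_variationSum_le (T : C(Y, ℂ) →ₗ[ℂ] Lp ℂ 1 m) (p : PartitionOfOne Y) (g : C(Y, ℂ)) :
    ‖variationSum T p g‖ ≤ ∑ i, ‖T (p.χ i * g)‖ :=
  (norm_sum_le _ _).trans_eq (Finset.sum_congr rfl fun _ _ ↦ norm_lpAbs _)

/-- The sums `∑ ‖T uᵢ‖` over finite families with `∑ |uᵢ| ≤ 1` are bounded by `B`. -/
def VariationBound (T : C(Y, ℂ) →ₗ[ℂ] Lp ℂ 1 m) (B : ℝ) : Prop :=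
  ∀ (ι : Type) [Fintype ι] (u : ι → C(Y, ℂ)), (∀ t, ∑ i, ‖u i t‖ ≤ 1) → ∑ i, ‖T (u i)‖ ≤ B

theorem VariationBound.sum_norm_le {T : C(Y, ℂ) →ₗ[ℂ] Lp ℂ 1 m} {B : ℝ} (hT : VariationBound T B)
    {ι : Type} [Fintype ι] {u : ι → C(Y, ℂ)} {c : ℝ} (hc : 0 < c) (hu : ∀ t, ∑ i, ‖u i t‖ ≤ c) :
    ∑ i, ‖T (u i)‖ ≤ c * B := by
  have h := hT ι (fun i ↦ ((c⁻¹ : ℝ) : ℂ) • u i) fun t ↦ by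
    simp only [ContinuousMap.smul_apply, norm_smul, ← Finset.mul_sum, Complex.norm_real,
      Real.norm_of_nonneg (inv_nonneg.2 hc.le)]
    rw [inv_mul_le_iff₀ hc, mul_one]
    exact hu t
  simp only [map_smul, norm_smul, ← Finset.mul_sum, Complex.norm_real,
    Real.norm_of_nonneg (inv_nonneg.2 hc.le)] at h
  rwa [inv_mul_le_iff₀ hc] at h

theorem PartitionOfOne.sum_norm_mul_le (p : PartitionOfOne Y) (g : C(Y, ℂ)) (t : Y) :
    ∑ i, ‖(p.χ i * g) t‖ ≤ ‖g t‖ := by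
  simp_rw [ContinuousMap.mul_apply, norm_mul, ← Finset.sum_mul]
  exact mul_le_of_le_one_left (norm_nonneg _) (p.sum_norm_le t)

/-- The Riemann sums approximating the modulus of `T` at `f`. -/
def riemannSum (T : C(Y, ℂ) →ₗ[ℂ] Lp ℂ 1 m) (p : PartitionOfOne Y) (f : C(Y, ℂ)) : Lp ℂ 1 m :=
  ∑ i, p.sample f i • lpOfReal (lpAbs (T (p.χ i)))

theorem riemannSum_add (T : C(Y, ℂ) →ₗ[ℂ] Lp ℂ 1 m) (p : PartitionOfOne Y) (f g : C(Y, ℂ)) :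
    riemannSum T p (f + g) = riemannSum T p f + riemannSum T p g := by
  simp_rw [riemannSum, p.sample_add, add_smul, Finset.sum_add_distrib]

theorem riemannSum_smul (T : C(Y, ℂ) →ₗ[ℂ] Lp ℂ 1 m) (p : PartitionOfOne Y) (c : ℂ)
    (f : C(Y, ℂ)) : riemannSum T p (c • f) = c • riemannSum T p f := by
  simp_rw [riemannSum, p.sample_smul, mul_smul, Finset.smul_sum]

theorem norm_riemannSum_sub_le {T : C(Y, ℂ) →ₗ[ℂ] Lp ℂ 1 m} {B : ℝ} (hT : VariationBound T B)
    {p : PartitionOfOne Y} {g : C(Y, ℂ)} {ε : ℝ} (hε : 0 < ε)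
    (hp : ∀ i s t, p.χ i s ≠ 0 → p.χ i t ≠ 0 → ‖g s - g t‖ < ε) :
    ‖riemannSum T p (modulusFun g) - lpOfReal (variationSum T p g)‖ ≤ ε * B := by
  have h : riemannSum T p (modulusFun g) = lpOfReal (∑ i, lpAbs (T (p.sample g i • p.χ i))) := by
    rw [riemannSum, map_sum]
    refine Finset.sum_congr rfl fun i _ ↦ ?_
    rw [p.sample_modulusFun, map_smul, lpAbs_smul, map_smul, Complex.coe_smul]
    rfl
  rw [h, ← map_sub, norm_lpOfReal, variationSum, ← Finset.sum_sub_distrib]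
  calc _ ≤ ∑ i, ‖T (p.sample g i • p.χ i - p.χ i * g)‖ := by
        refine (norm_sum_le _ _).trans (Finset.sum_le_sum fun i _ ↦ ?_)
        rw [map_sub]
        exact norm_lpAbs_sub_le _ _
    _ ≤ ε * B := hT.sum_norm_le hε fun t ↦ ?_
  calc _ ≤ ∑ i, ‖p.χ i t‖ * ε := by
        refine Finset.sum_le_sum fun i _ ↦ ?_
        by_cases ht : p.χ i t = 0
        · simp [ht]
        · have : (p.sample g i • p.χ i - p.χ i * g) t = p.χ i t * (p.sample g i - g t) := by
            simp only [ContinuousMap.sub_apply, ContinuousMap.smul_apply, ContinuousMap.mul_apply,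
              smul_eq_mul]
            ring
          rw [this, norm_mul]
          gcongr
          exact (PartitionOfOne.norm_sample_sub_lt (hp i) ht).le
    _ ≤ ε := by
        rw [← Finset.sum_mul]
        exact mul_le_of_le_one_left hε.le (p.sum_norm_le t)

variable [CompactSpace Y]

theorem VariationBound.exists_tendsto_variationSum {T : C(Y, ℂ) →ₗ[ℂ] Lp ℂ 1 m} {B : ℝ}
    (hT : VariationBound T B) (g : C(Y, ℂ)) :
    ∃ u, Filter.Tendsto (fun p ↦ variationSum T p g) Filter.atTop (nhds u) :=
  lp_exists_tendsto_of_monotone (variationSum_mono T g) (fun p ↦ variationSum_nonneg T p g)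
    fun p ↦ (norm_variationSum_le T p g).trans <|
      hT.sum_norm_le (c := ‖g‖ + 1) (by positivity) fun t ↦
        (p.sum_norm_mul_le g t).trans ((g.norm_coe_le_norm t).trans (by linarith))

variable [T2Space Y]

theorem VariationBound.tendsto_riemannSum {T : C(Y, ℂ) →ₗ[ℂ] Lp ℂ 1 m} {B : ℝ}
    (hT : VariationBound T B) {g : C(Y, ℂ)} {u : Lp ℝ 1 m}
    (hu : Filter.Tendsto (fun p ↦ variationSum T p g) Filter.atTop (nhds u)) :
    Filter.Tendsto (fun p ↦ riemannSum T p (modulusFun g)) Filter.atTop (nhds (lpOfReal u)) := by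
  have h : Filter.Tendsto
      (fun p ↦ riemannSum T p (modulusFun g) - lpOfReal (variationSum T p g))
      Filter.atTop (nhds 0) := by
    rw [Metric.tendsto_nhds]
    intro ε hε
    have hB : 0 < |B| + 1 := by positivity
    filter_upwards [PartitionOfOne.eventually_oscillation_lt g (div_pos hε hB)] with p hp
    rw [dist_zero_right]
    refine (norm_riemannSum_sub_le hT (div_pos hε hB) hp).trans_lt ?_
    rw [div_mul_eq_mul_div, div_lt_iff₀ hB]
    nlinarith [le_abs_self B]
  simpa using h.add ((lpOfReal.continuous.tendsto u).comp hu)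

/-- The modulus of an operator of bounded variation, as a limit of variation sums. -/
theorem VariationBound.exists_modulus {T : C(Y, ℂ) →ₗ[ℂ] Lp ℂ 1 m} {B : ℝ}
    (hT : VariationBound T B) :
    ∃ S : C(Y, ℂ) →ₗ[ℂ] Lp ℂ 1 m, ∀ g, ∃ u : Lp ℝ 1 m,
      Filter.Tendsto (fun p ↦ variationSum T p g) Filter.atTop (nhds u) ∧
        S (modulusFun g) = lpOfReal u := by
  have hex : ∀ f, ∃ v, Filter.Tendsto (fun p ↦ riemannSum T p f) Filter.atTop (nhds v) := by
    intro f
    have hf : f ∈ Submodule.span ℂ {a : C(Y, ℂ) | 0 ≤ a} := by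
      rw [CStarAlgebra.span_nonneg]; trivial
    induction hf using Submodule.span_induction with
    | mem f hf =>
      obtain ⟨u, hu⟩ := hT.exists_tendsto_variationSum f
      have := hT.tendsto_riemannSum hu
      rw [modulusFun_of_nonneg (ContinuousMap.le_def.1 hf)] at this
      exact ⟨_, this⟩
    | zero => exact ⟨0, tendsto_const_nhds.congr fun p ↦ by
        simpa using (riemannSum_smul T p 0 0).symm⟩
    | add f g _ _ hf hg =>
      obtain ⟨v, hv⟩ := hf
      obtain ⟨w, hw⟩ := hg
      exact ⟨v + w, (hv.add hw).congr fun p ↦ (riemannSum_add T p f g).symm⟩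
    | smul c f _ hf =>
      obtain ⟨v, hv⟩ := hf
      exact ⟨c • v, (hv.const_smul c).congr fun p ↦ (riemannSum_smul T p c f).symm⟩
  choose S hS using hex
  refine ⟨{ toFun := S, map_add' := fun f g ↦ ?_, map_smul' := fun c f ↦ ?_ }, fun g ↦ ?_⟩
  · exact tendsto_nhds_unique (hS _)
      (((hS f).add (hS g)).congr fun p ↦ (riemannSum_add T p f g).symm)
  · exact tendsto_nhds_unique (hS _)
      (((hS f).const_smul c).congr fun p ↦ (riemannSum_smul T p c f).symm)
  · obtain ⟨u, hu⟩ := hT.exists_tendsto_variationSum g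
    exact ⟨u, hu, tendsto_nhds_unique (hS _) (hT.tendsto_riemannSum hu)⟩

end Modulus

section Domination

variable {Y : Type*} [TopologicalSpace Y] {Z : Type*} [MeasurableSpace Z] {m : Measure Z}

/-- `P` dominates `T`: `|T g| ≤ P |g|` almost everywhere, for every continuous `g`. -/
def Dominates (P T : C(Y, ℂ) →ₗ[ℂ] Lp ℂ 1 m) : Prop :=
  ∀ g : C(Y, ℂ), ∀ᵐ x ∂m, (‖T g x‖ : ℂ) ≤ P (modulusFun g) x

theorem PositiveOp.mono {P : C(Y, ℂ) →ₗ[ℂ] Lp ℂ 1 m} (hP : PositiveOp ⇑P) {f g : C(Y, ℂ)}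
    (hfg : ∀ t, f t ≤ g t) : ∀ᵐ x ∂m, P f x ≤ P g x := by
  have h := hP (g - f) fun t ↦ sub_nonneg.2 (hfg t)
  rw [map_sub] at h
  filter_upwards [h, Lp.coeFn_sub (P g) (P f)] with x h1 h2
  rw [h2, Pi.sub_apply] at h1
  exact sub_nonneg.1 h1

theorem PositiveOp.re_apply_le {P : C(Y, ℂ) →ₗ[ℂ] Lp ℂ 1 m} (hP : PositiveOp ⇑P) (w : C(Y, ℂ)) :
    ∀ᵐ x ∂m, (P w x).re ≤ (P (modulusFun w) x).re := by
  let u : C(Y, ℂ) := ⟨fun t ↦ ((w t).re : ℂ), by fun_prop⟩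
  let v : C(Y, ℂ) := ⟨fun t ↦ ((w t).im : ℂ), by fun_prop⟩
  have hw : w = u + Complex.I • v := by
    ext t
    simp [u, v, mul_comm Complex.I, Complex.re_add_im]
  have hPw : P w = P u + Complex.I • P v := by rw [← map_smul, ← map_add, ← hw]
  have hu := hP.mono (f := u) (g := modulusFun w) fun t ↦
    Complex.real_le_real.2 (Complex.re_le_norm _)
  have hv := hP.mono (f := v) (g := modulusFun w) fun t ↦
    Complex.real_le_real.2 (Complex.im_le_norm _)
  have h0 := hP _ (modulusFun_nonneg w)
  filter_upwards [hu, hv, h0, Lp.coeFn_add (P u) (Complex.I • P v),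
    Lp.coeFn_smul Complex.I (P v)] with x h1 h2 h3 h4 h5
  rw [Complex.le_def] at h1 h2 h3
  rw [hPw, h4, Pi.add_apply, h5, Pi.smul_apply]
  have h6 : (P v x).im = 0 := by rw [h2.2, ← h3.2]; rfl
  simpa [h6] using h1.1

theorem PositiveOp.dominates_self {P : C(Y, ℂ) →ₗ[ℂ] Lp ℂ 1 m} (hP : PositiveOp ⇑P) :
    Dominates P P := by
  intro g
  have h1 : ∀ᵐ x ∂m, ∀ n : ℕ, (TopologicalSpace.denseSeq ℂ n * P g x).re ≤
      ‖TopologicalSpace.denseSeq ℂ n‖ * (P (modulusFun g) x).re := by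
    rw [ae_all_iff]
    intro n
    set c := TopologicalSpace.denseSeq ℂ n
    have hc : modulusFun (c • g) = (‖c‖ : ℂ) • modulusFun g := by
      ext t
      simp [modulusFun_apply]
    have h := hP.re_apply_le (c • g)
    rw [hc, map_smul, map_smul] at h
    filter_upwards [h, Lp.coeFn_smul c (P g), Lp.coeFn_smul (‖c‖ : ℂ) (P (modulusFun g))]
      with x h1 h2 h3
    rw [h2, h3] at h1
    simpa using h1
  filter_upwards [h1, hP _ (modulusFun_nonneg g)] with x h1 h2
  have h3 : ∀ c : ℂ, (c * P g x).re ≤ ‖c‖ * (P (modulusFun g) x).re := fun c ↦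
    (TopologicalSpace.denseRange_denseSeq ℂ).induction_on c
      (isClosed_le (by fun_prop) (by fun_prop)) h1
  rw [Complex.le_def] at h2 ⊢
  refine ⟨?_, by simpa using h2.2⟩
  rw [Complex.ofReal_re]
  have h4 := h3 (conj (P g x))
  rw [← Complex.normSq_eq_conj_mul_self, Complex.ofReal_re, Complex.normSq_eq_norm_sq,
    Complex.norm_conj, sq] at h4
  rcases (norm_nonneg (P g x)).eq_or_lt with h5 | h5
  · rw [← h5]; exact h2.1
  · exact le_of_mul_le_mul_left h4 h5

theorem Dominates.positiveOp {P T : C(Y, ℂ) →ₗ[ℂ] Lp ℂ 1 m} (h : Dominates P T) :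
    PositiveOp ⇑P := by
  intro f hf
  filter_upwards [h f] with x hx
  rw [modulusFun_of_nonneg hf] at hx
  exact le_trans (by simp) hx

theorem Dominates.add {P Q T U : C(Y, ℂ) →ₗ[ℂ] Lp ℂ 1 m} (hT : Dominates P T)
    (hU : Dominates Q U) : Dominates (P + Q) (T + U) := by
  intro g
  filter_upwards [hT g, hU g, Lp.coeFn_add (T g) (U g),
    Lp.coeFn_add (P (modulusFun g)) (Q (modulusFun g))] with x h1 h2 h3 h4
  rw [LinearMap.add_apply, LinearMap.add_apply, h3, h4, Pi.add_apply, Pi.add_apply]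
  refine le_trans ?_ (add_le_add h1 h2)
  rw [← Complex.ofReal_add]
  exact Complex.real_le_real.2 (norm_add_le _ _)

theorem Dominates.smul {P T : C(Y, ℂ) →ₗ[ℂ] Lp ℂ 1 m} (hT : Dominates P T) (c : ℂ) :
    Dominates ((‖c‖ : ℂ) • P) (c • T) := by
  intro g
  filter_upwards [hT g, Lp.coeFn_smul c (T g), Lp.coeFn_smul (‖c‖ : ℂ) (P (modulusFun g))]
    with x h1 h2 h3
  rw [LinearMap.smul_apply, LinearMap.smul_apply, h2, h3, Pi.smul_apply, Pi.smul_apply, norm_smul,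
    Complex.ofReal_mul, smul_eq_mul]
  exact mul_le_mul_of_nonneg_left h1 (by simp)

theorem dominates_zero : Dominates (0 : C(Y, ℂ) →ₗ[ℂ] Lp ℂ 1 m) 0 := by
  intro g
  filter_upwards [Lp.coeFn_zero ℂ 1 m] with x hx
  simp only [LinearMap.zero_apply]
  rw [hx]
  simp

theorem dominates_sum {ι : Type*} (s : Finset ι) {P T : ι → (C(Y, ℂ) →ₗ[ℂ] Lp ℂ 1 m)}
    (h : ∀ i, Dominates (P i) (T i)) : Dominates (∑ i ∈ s, P i) (∑ i ∈ s, T i) := by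
  classical
  induction s using Finset.induction_on with
  | empty => simpa using dominates_zero
  | insert i s hi ih => simpa [Finset.sum_insert hi] using (h i).add ih

theorem RegularOp.exists_dominates {T : C(Y, ℂ) →ₗ[ℂ] Lp ℂ 1 m} (hT : RegularOp T) :
    ∃ P, Dominates P T := by
  obtain ⟨n, c, P, hP, rfl⟩ := hT
  exact ⟨_, dominates_sum _ fun i ↦ (hP i).dominates_self.smul (c i)⟩

theorem Dominates.orderBounded {P T : C(Y, ℂ) →ₗ[ℂ] Lp ℂ 1 m} (h : Dominates P T) :
    OrderBounded ⇑T := by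
  intro f hf
  refine ⟨P f, h.positiveOp f hf, fun g hg ↦ ?_⟩
  filter_upwards [h g, h.positiveOp.mono (f := modulusFun g) hg] with x h1 h2
  exact h1.trans h2

/-- The operator `f ↦ conj (T (conj f))`. -/
def conjOp (T : C(Y, ℂ) →ₗ[ℂ] Lp ℂ 1 m) : C(Y, ℂ) →ₗ[ℂ] Lp ℂ 1 m where
  toFun f := star (T (star f))
  map_add' f g := by
    refine Lp.ext ?_
    rw [star_add, map_add]
    filter_upwards [Lp.coeFn_star (T (star f) + T (star g)), Lp.coeFn_star (T (star f)),
      Lp.coeFn_star (T (star g)), Lp.coeFn_add (T (star f)) (T (star g)),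
      Lp.coeFn_add (star (T (star f))) (star (T (star g)))] with x h1 h2 h3 h4 h5
    rw [h1, h5, Pi.star_apply, h4, Pi.add_apply, Pi.add_apply, h2, h3, star_add]
    rfl
  map_smul' c f := by
    refine Lp.ext ?_
    rw [star_smul, map_smul, RingHom.id_apply]
    filter_upwards [Lp.coeFn_star (star c • T (star f)), Lp.coeFn_smul (star c) (T (star f)),
      Lp.coeFn_smul c (star (T (star f))), Lp.coeFn_star (T (star f))] with x h1 h2 h3 h4
    rw [h1, h3, Pi.star_apply, h2, Pi.smul_apply, Pi.smul_apply, h4, star_smul, star_star]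
    rfl

theorem coeFn_conjOp (T : C(Y, ℂ) →ₗ[ℂ] Lp ℂ 1 m) {f : C(Y, ℂ)} (hf : ∀ t, 0 ≤ f t) :
    ∀ᵐ x ∂m, conjOp T f x = conj (T f x) := by
  have h : star f = f := by
    ext t
    exact Complex.conj_eq_iff_im.2 (Complex.le_def.1 (hf t)).2.symm
  have h' : conjOp T f = star (T f) := by
    rw [← congrArg T h]; rfl
  rw [h']
  exact Lp.coeFn_star (T f)

theorem Dominates.regularOp {P T : C(Y, ℂ) →ₗ[ℂ] Lp ℂ 1 m} (h : Dominates P T) :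
    RegularOp T := by
  refine ⟨3, ![1, Complex.I, -1 - Complex.I],
    ![(2⁻¹ : ℂ) • (T + conjOp T) + P, (-(2⁻¹ * Complex.I)) • (T - conjOp T) + P, P], ?_, ?_⟩
  · have key : ∀ z w : ℂ, (‖z‖ : ℂ) ≤ w → 0 ≤ (2⁻¹ : ℂ) * (z + conj z) + w ∧
        0 ≤ (-(2⁻¹ * Complex.I)) * (z - conj z) + w := by
      intro z w hzw
      rw [Complex.le_def, Complex.ofReal_re, Complex.ofReal_im] at hzw
      have hre := Complex.abs_re_le_norm z
      have him := Complex.abs_im_le_norm z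
      rw [Complex.add_conj, Complex.sub_conj]
      have h1 : (2⁻¹ : ℂ) * ((2 * z.re : ℝ) : ℂ) = (z.re : ℂ) := by push_cast; ring
      have h2 : (-(2⁻¹ * Complex.I)) * (((2 * z.im : ℝ) : ℂ) * Complex.I) = (z.im : ℂ) := by
        push_cast
        linear_combination (-(z.im : ℂ)) * Complex.I_sq
      rw [h1, h2]
      constructor <;> rw [Complex.le_def] <;> refine ⟨?_, by simp [← hzw.2]⟩ <;>
        simp only [Complex.zero_re, Complex.add_re, Complex.ofReal_re]
      · linarith [neg_abs_le z.re, hzw.1]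
      · linarith [neg_abs_le z.im, hzw.1]
    intro i f hf
    fin_cases i
    · simp only [Fin.zero_eta, Matrix.cons_val_zero, LinearMap.add_apply, LinearMap.smul_apply]
      filter_upwards [h f, coeFn_conjOp T hf, Lp.coeFn_add (T f) (conjOp T f),
        Lp.coeFn_smul (2⁻¹ : ℂ) (T f + conjOp T f),
        Lp.coeFn_add ((2⁻¹ : ℂ) • (T f + conjOp T f)) (P f)] with x h1 h2 h3 h4 h5
      rw [h5, Pi.add_apply, h4, Pi.smul_apply, h3, Pi.add_apply, h2, smul_eq_mul]
      rw [modulusFun_of_nonneg hf] at h1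
      exact (key _ _ h1).1
    · simp only [Fin.mk_one, Matrix.cons_val_one, Matrix.cons_val_zero, LinearMap.add_apply,
        LinearMap.smul_apply, LinearMap.sub_apply]
      filter_upwards [h f, coeFn_conjOp T hf, Lp.coeFn_sub (T f) (conjOp T f),
        Lp.coeFn_smul (-(2⁻¹ * Complex.I)) (T f - conjOp T f),
        Lp.coeFn_add ((-(2⁻¹ * Complex.I)) • (T f - conjOp T f)) (P f)] with x h1 h2 h3 h4 h5
      rw [h5, Pi.add_apply, h4, Pi.smul_apply, h3, Pi.sub_apply, h2, smul_eq_mul]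
      rw [modulusFun_of_nonneg hf] at h1
      exact (key _ _ h1).2
    · exact h.positiveOp f hf
  · simp only [Fin.sum_univ_three, Matrix.cons_val_zero, Matrix.cons_val_one, Matrix.cons_val]
    have hI : Complex.I * (2⁻¹ * Complex.I) = -2⁻¹ := by
      linear_combination (2⁻¹ : ℂ) * Complex.I_sq
    simp only [smul_add, smul_sub, sub_smul, neg_smul, one_smul, smul_neg, smul_smul, hI]
    module

theorem VariationBound.exists_dominates [CompactSpace Y] [T2Space Y]
    {T : C(Y, ℂ) →ₗ[ℂ] Lp ℂ 1 m} {B : ℝ} (hT : VariationBound T B) :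
    ∃ S, Dominates S T ∧ ∀ g : C(Y, ℂ), ∀ C : ℝ, (∀ p, ‖variationSum T p g‖ ≤ C) →
      ‖S (modulusFun g)‖ ≤ C := by
  obtain ⟨S, hS⟩ := hT.exists_modulus
  refine ⟨S, fun g ↦ ?_, fun g C hC ↦ ?_⟩ <;> obtain ⟨u, hu, hSu⟩ := hS g <;> rw [hSu]
  · have hle : lpAbs (T g) ≤ u := ge_of_tendsto' hu fun p ↦ lpAbs_le_variationSum T p g
    filter_upwards [(Lp.coeFn_le _ _).2 hle, coeFn_lpAbs (T g), coeFn_lpOfReal u] with x h1 h2 h3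
    rw [h3, ← h2]
    exact Complex.real_le_real.2 h1
  · rw [norm_lpOfReal]
    exact le_of_tendsto' hu.norm hC

theorem OrderBounded.exists_variationBound {T : C(Y, ℂ) →ₗ[ℂ] Lp ℂ 1 m}
    (hT : OrderBounded ⇑T) : ∃ B, VariationBound T B := by
  classical
  obtain ⟨h, -, hh⟩ := hT 1 (by simp)
  refine ⟨∫ x, 2 * (h x).re ∂m, fun ι _ u hu ↦ ?_⟩
  have hae : ∀ᵐ x ∂m, ∀ s : ι → SignType, ‖∑ i, ((s i : ℝ) : ℂ) * T (u i) x‖ ≤ (h x).re := by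
    rw [ae_all_iff]
    intro s
    have hs := hh (∑ i, ((s i : ℝ) : ℂ) • u i) fun t ↦ by
      have hle : ‖(∑ i, ((s i : ℝ) : ℂ) • u i) t‖ ≤ 1 := by
        rw [ContinuousMap.sum_apply]
        refine (norm_sum_le _ _).trans ((Finset.sum_le_sum fun i _ ↦ ?_).trans (hu t))
        rw [ContinuousMap.smul_apply, norm_smul]
        refine mul_le_of_le_one_left (norm_nonneg _) ?_
        cases s i <;> simp
      simpa using Complex.real_le_real.2 hle
    rw [map_sum] at hs
    have hsm : ∀ᵐ x ∂m, ∀ i, T (((s i : ℝ) : ℂ) • u i) x = ((s i : ℝ) : ℂ) * T (u i) x := by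
      rw [ae_all_iff]
      intro i
      rw [map_smul]
      exact Lp.coeFn_smul _ _
    filter_upwards [hs, hsm, Lp.coeFn_fun_finsetSum Finset.univ
      fun i ↦ T (((s i : ℝ) : ℂ) • u i)] with x h1 h2 h3
    rw [h3, Finset.sum_congr rfl fun i _ ↦ h2 i] at h1
    exact (Complex.le_def.1 h1).1
  simp_rw [L1.norm_eq_integral_norm]
  rw [← integral_finsetSum _ fun i _ ↦ (L1.integrable_coeFn (T (u i))).norm]
  refine integral_mono_ae (integrable_finsetSum _ fun i _ ↦ (L1.integrable_coeFn _).norm)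
    ((L1.integrable_coeFn h).re.const_mul 2) ?_
  filter_upwards [hae] with x hx
  have hre : ∑ i, |(T (u i) x).re| ≤ (h x).re := by
    refine le_trans (le_of_eq ?_) ((Complex.re_le_norm _).trans
      (hx fun i ↦ SignType.sign (T (u i) x).re))
    simp [Complex.re_sum, sign_mul_self]
  have him : ∑ i, |(T (u i) x).im| ≤ (h x).re := by
    refine le_trans (le_of_eq ?_) ((Complex.im_le_norm _).trans
      (hx fun i ↦ SignType.sign (T (u i) x).im))
    simp [Complex.im_sum, sign_mul_self]
  calc ∑ i, ‖T (u i) x‖ ≤ ∑ i, (|(T (u i) x).re| + |(T (u i) x).im|) :=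
        Finset.sum_le_sum fun i _ ↦ Complex.norm_le_abs_re_add_abs_im _
    _ ≤ 2 * (h x).re := by
        rw [Finset.sum_add_distrib]
        linarith

theorem re_integral_le_norm (u : Lp ℂ 1 m) : (∫ x, u x ∂m).re ≤ ‖u‖ := by
  rw [L1.norm_eq_integral_norm]
  exact (Complex.re_le_norm _).trans (norm_integral_le_integral_norm _)

theorem re_integral_mono {u v : Lp ℂ 1 m} (h : ∀ᵐ x ∂m, u x ≤ v x) :
    (∫ x, u x ∂m).re ≤ (∫ x, v x ∂m).re := by
  have hu := integral_re (L1.integrable_coeFn u)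
  have hv := integral_re (L1.integrable_coeFn v)
  simp only [RCLike.re_to_complex] at hu hv
  rw [← hu, ← hv]
  refine integral_mono_ae (L1.integrable_coeFn u).re (L1.integrable_coeFn v).re ?_
  filter_upwards [h] with x hx
  exact (Complex.le_def.1 hx).1

theorem Dominates.norm_apply_le {P T : C(Y, ℂ) →ₗ[ℂ] Lp ℂ 1 m} (h : Dominates P T)
    (g : C(Y, ℂ)) : ‖T g‖ ≤ (∫ x, P (modulusFun g) x ∂m).re := by
  have hv := integral_re (L1.integrable_coeFn (P (modulusFun g)))
  simp only [RCLike.re_to_complex] at hv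
  rw [← hv, L1.norm_eq_integral_norm]
  refine integral_mono_ae (L1.integrable_coeFn (T g)).norm
    (L1.integrable_coeFn (P (modulusFun g))).re ?_
  filter_upwards [h g] with x hx
  exact (Complex.le_def.1 hx).1

end Domination

section RepresentingMeasure

theorem continuous_integrable_of_compactSpace {Y E : Type*} [TopologicalSpace Y]
    [CompactSpace Y] [MeasurableSpace Y] [OpensMeasurableSpace Y] [NormedAddCommGroup E]
    (ν : Measure Y) [IsFiniteMeasure ν] {f : Y → E} (hf : Continuous f) : Integrable f ν :=
  hf.integrable_of_hasCompactSupport (HasCompactSupport.of_compactSpace f)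

/-- Regular finite measures are ordered by their integrals of nonnegative continuous functions. -/
theorem measure_le_of_integral_le {ν₀ ν : Measure K} [ν₀.Regular] [ν.Regular] [IsFiniteMeasure ν₀]
    [IsFiniteMeasure ν]
    (h : ∀ f : C(K, ℝ), (∀ t, 0 ≤ f t) → ∫ t, f t ∂ν₀ ≤ ∫ t, f t ∂ν) : ν₀ ≤ ν := by
  have hopen : ∀ U : Set K, IsOpen U → ν₀ U ≤ ν U := by
    intro U hU
    rw [hU.measure_eq_iSup_isCompact ν₀]
    refine iSup₂_le fun C hCU ↦ iSup_le fun hC ↦ ?_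
    obtain ⟨f, hf1, -, hfU, hf01⟩ := exists_continuousMap_one_of_isCompact_subset_isOpen hC hU hCU
    have hfint : ∀ ρ : Measure K, [IsFiniteMeasure ρ] → Integrable f ρ := fun ρ _ ↦
      continuous_integrable_of_compactSpace ρ f.continuous
    have h1 : ν₀.real C ≤ ∫ t, f t ∂ν₀ := by
      rw [← integral_indicator_one hC.measurableSet]
      refine integral_mono ((integrable_const 1).indicator hC.measurableSet) (hfint ν₀) fun t ↦ ?_
      by_cases ht : t ∈ C
      · simp [ht, hf1 ht]
      · simp [ht, (hf01 t).1]
    have h2 : ∫ t, f t ∂ν ≤ ν.real U := by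
      rw [← integral_indicator_one hU.measurableSet]
      refine integral_mono (hfint ν) ((integrable_const 1).indicator hU.measurableSet) fun t ↦ ?_
      by_cases ht : t ∈ tsupport f
      · simp [hfU ht, (hf01 t).2]
      · simp [image_eq_zero_of_notMem_tsupport ht, Set.indicator_nonneg]
    exact (ENNReal.toReal_le_toReal (measure_ne_top _ _) (measure_ne_top _ _)).1
      (h1.trans ((h f fun t ↦ (hf01 t).1).trans h2))
  refine Measure.le_iff.2 fun A _ ↦ ?_
  rw [A.measure_eq_iInf_isOpen ν]
  exact le_iInf₂ fun U hAU ↦ le_iInf fun hU ↦ (measure_mono hAU).trans (hopen U hU)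

theorem Dominates.exists_measure {P T : C(K, ℂ) →ₗ[ℂ] Lp ℂ 1 μ} (h : Dominates P T) :
    ∃ ν : Measure K, ν.Regular ∧ IsFiniteMeasure ν ∧
      ∀ f : C(K, ℂ), ‖T f‖ ≤ ∫ t, ‖f t‖ ∂ν := by
  let toC : CompactlySupportedContinuousMap K ℝ → C(K, ℂ) :=
    fun f ↦ ⟨fun t ↦ (f t : ℂ), by fun_prop⟩
  have hadd : ∀ f g, toC (f + g) = toC f + toC g := fun f g ↦ by ext t; simp [toC]
  have hsmul : ∀ (c : ℝ) f, toC (c • f) = (c : ℂ) • toC f := fun c f ↦ by ext t; simp [toC]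
  let Λ : CompactlySupportedContinuousMap K ℝ →ₚ[ℝ] ℝ := PositiveLinearMap.mk₀
    { toFun := fun f ↦ (∫ x, P (toC f) x ∂μ).re
      map_add' := fun f g ↦ by
        rw [hadd, map_add, integral_congr_ae (Lp.coeFn_add _ _)]
        simp only [Pi.add_apply]
        rw [integral_add (L1.integrable_coeFn _) (L1.integrable_coeFn _), Complex.add_re]
      map_smul' := fun c f ↦ by
        rw [hsmul, map_smul, integral_congr_ae (Lp.coeFn_smul _ _)]
        simp only [Pi.smul_apply]
        rw [integral_smul]
        simp }
    fun f hf ↦ by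
      have h0 := h.positiveOp (toC f) fun t ↦ Complex.zero_le_real.2 (hf t)
      have hre := integral_re (L1.integrable_coeFn (P (toC f)))
      simp only [RCLike.re_to_complex] at hre
      change 0 ≤ (∫ x, P (toC f) x ∂μ).re
      rw [← hre]
      refine integral_nonneg_of_ae ?_
      filter_upwards [h0] with x hx
      exact (Complex.le_def.1 hx).1
  refine ⟨RealRMK.rieszMeasure Λ, inferInstance, inferInstance, fun f ↦ ?_⟩
  let φ : CompactlySupportedContinuousMap K ℝ :=
    ⟨⟨fun t ↦ ‖f t‖, by fun_prop⟩, HasCompactSupport.of_compactSpace _⟩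
  exact (h.norm_apply_le f).trans_eq (RealRMK.integral_rieszMeasure Λ φ).symm

theorem sum_norm_le_integral {T : C(K, ℂ) →ₗ[ℂ] Lp ℂ 1 μ} {ν : Measure K} [IsFiniteMeasure ν]
    (hν : ∀ f : C(K, ℂ), ‖T f‖ ≤ ∫ t, ‖f t‖ ∂ν) {ι : Type*} [Fintype ι] {u : ι → C(K, ℂ)}
    {g : K → ℝ} (hg : Continuous g) (hu : ∀ t, ∑ i, ‖u i t‖ ≤ g t) :
    ∑ i, ‖T (u i)‖ ≤ ∫ t, g t ∂ν := by
  have hint : ∀ i, Integrable (fun t ↦ ‖u i t‖) ν := fun i ↦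
    continuous_integrable_of_compactSpace ν (by fun_prop)
  calc ∑ i, ‖T (u i)‖ ≤ ∑ i, ∫ t, ‖u i t‖ ∂ν := Finset.sum_le_sum fun i _ ↦ hν _
    _ = ∫ t, ∑ i, ‖u i t‖ ∂ν := (integral_finsetSum _ fun i _ ↦ hint i).symm
    _ ≤ ∫ t, g t ∂ν := integral_mono (integrable_finsetSum _ fun i _ ↦ hint i)
        (continuous_integrable_of_compactSpace ν hg) hu

/-- An operator that is contractive from `L¹(ν)` to `L¹` is dominated by an operator with the same
bound on moduli. -/
theorem exists_dominates_of_norm_le_integral {T : C(K, ℂ) →ₗ[ℂ] Lp ℂ 1 μ} {ν : Measure K}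
    [IsFiniteMeasure ν] (hν : ∀ f : C(K, ℂ), ‖T f‖ ≤ ∫ t, ‖f t‖ ∂ν) :
    ∃ S, Dominates S T ∧ ∀ g : C(K, ℂ), ‖S (modulusFun g)‖ ≤ ∫ t, ‖g t‖ ∂ν := by
  have hT : VariationBound T (∫ _, 1 ∂ν) := fun ι _ u hu ↦
    sum_norm_le_integral hν continuous_const hu
  obtain ⟨S, hST, hS⟩ := hT.exists_dominates
  exact ⟨S, hST, fun g ↦ hS g _ fun p ↦ (norm_variationSum_le T p g).trans
    (sum_norm_le_integral hν (by fun_prop) (p.sum_norm_mul_le g))⟩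

/-- The representing measure of the modulus is dominated, on moduli of continuous functions, by
every measure that controls the operator. -/
theorem IsLinearModulus.re_integral_le {T absT : C(K, ℂ) →ₗ[ℂ] Lp ℂ 1 μ}
    (habs : IsLinearModulus ⇑T ⇑absT) {ν : Measure K} [IsFiniteMeasure ν]
    (hν : ∀ f : C(K, ℂ), ‖T f‖ ≤ ∫ t, ‖f t‖ ∂ν) (g : C(K, ℂ)) :
    (∫ x, absT (modulusFun g) x ∂μ).re ≤ ∫ t, ‖g t‖ ∂ν := by
  obtain ⟨S, hST, hS⟩ := exists_dominates_of_norm_le_integral hν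
  refine (re_integral_mono ((habs _ (modulusFun_nonneg g)).2 (S (modulusFun g)) ?_)).trans
    ((re_integral_le_norm _).trans (hS g))
  intro f hf
  filter_upwards [hST f, hST.positiveOp.mono (f := modulusFun f) hf] with x h1 h2
  exact h1.trans h2

end RepresentingMeasure

/-- **Characterization of order-bounded operators `C(K) → L¹`**
(Theorem `ot.t:ob-char` of the paper).  For a linear operator `T : C(K;ℂ) → L¹(X)` the
following are equivalent: (i) `T` is order-bounded; (ii) `T` is regular; (iii) `T` is an
`L¹(ν)`-`L¹(μ)`-contraction for some finite positive regular Borel measure `ν` on `K`.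
In that case the measure `ν₀ = |T|'μ` (given by `∫_K f dν₀ = ∫_X |T|f dμ`) is the
smallest such `ν`, and every `ν` as in (iii) also works for `|T|`. -/
theorem orderBounded_tfae_and_minimal_measure
    (T : C(K, ℂ) →ₗ[ℂ] Lp ℂ 1 μ) :
    (OrderBounded ⇑T ↔ RegularOp T) ∧
    (OrderBounded ⇑T ↔
      ∃ ν : Measure K, ν.Regular ∧ IsFiniteMeasure ν ∧
        ∀ f : C(K, ℂ), ‖T f‖ ≤ ∫ t, ‖f t‖ ∂ν) ∧
    (∀ absT : C(K, ℂ) →ₗ[ℂ] Lp ℂ 1 μ, PositiveOp ⇑absT → IsLinearModulus ⇑T ⇑absT →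
      ∀ ν₀ : Measure K, ν₀.Regular → IsFiniteMeasure ν₀ →
        (∀ f : C(K, ℂ), ∫ t, f t ∂ν₀ = ∫ x, absT f x ∂μ) →
        ((∀ f : C(K, ℂ), ‖T f‖ ≤ ∫ t, ‖f t‖ ∂ν₀) ∧
         (∀ ν : Measure K, ν.Regular → IsFiniteMeasure ν →
            (∀ f : C(K, ℂ), ‖T f‖ ≤ ∫ t, ‖f t‖ ∂ν) → ν₀ ≤ ν) ∧
         (∀ ν : Measure K, ν.Regular → IsFiniteMeasure ν →
            (∀ f : C(K, ℂ), ‖T f‖ ≤ ∫ t, ‖f t‖ ∂ν) →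
            ∀ f : C(K, ℂ), ‖absT f‖ ≤ ∫ t, ‖f t‖ ∂ν))) := by
  have hdom : OrderBounded ⇑T → ∃ P, Dominates P T := fun h ↦ by
    obtain ⟨B, hB⟩ := h.exists_variationBound
    obtain ⟨S, hS, -⟩ := hB.exists_dominates
    exact ⟨S, hS⟩
  refine ⟨⟨fun h ↦ ?_, fun h ↦ ?_⟩, ⟨fun h ↦ ?_, ?_⟩, ?_⟩
  · obtain ⟨P, hP⟩ := hdom h
    exact hP.regularOp
  · obtain ⟨P, hP⟩ := h.exists_dominates
    exact hP.orderBounded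
  · obtain ⟨P, hP⟩ := hdom h
    exact hP.exists_measure
  · rintro ⟨ν, -, _, hν⟩
    obtain ⟨S, hS, -⟩ := exists_dominates_of_norm_le_integral hν
    exact hS.orderBounded
  · intro absT hpos habs ν₀ _ _ hν₀
    have hmod : ∀ f, (∫ x, absT (modulusFun f) x ∂μ).re = ∫ t, ‖f t‖ ∂ν₀ := fun f ↦ by
      rw [← hν₀]
      simp only [modulusFun_apply]
      rw [integral_complex_ofReal, Complex.ofReal_re]
    refine ⟨fun f ↦ ?_, fun ν _ _ hν ↦ ?_, fun ν _ _ hν f ↦ ?_⟩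
    · have hTabs : Dominates absT T := fun g ↦
        (habs _ (modulusFun_nonneg g)).1 g fun _ ↦ le_rfl
      exact (hTabs.norm_apply_le f).trans_eq (hmod f)
    · refine measure_le_of_integral_le fun f hf ↦ ?_
      have h := habs.re_integral_le hν ⟨fun t ↦ (f t : ℂ), by fun_prop⟩
      rw [hmod] at h
      simpa [abs_of_nonneg (hf _)] using h
    · exact (hpos.dominates_self.norm_apply_le f).trans (habs.re_integral_le hν f)

end
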